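/- Let Σ be a valid signature and I an initial object of CwF_Σ, with ⟦-⟧_C : I → C denoting the unique morphism to each object C of CwF_Σ. Then the map sending each object Γ₀ of I to the family (⟦Γ₀⟧_C)_{C ∈ CwF_Σ} is a bijection between the objects of I and the uniform families of contexts over CwF_Σ. -/

import Mathlib

universe u v w x u' v' w' x'

/-- A category with families (cwf): a category of contexts and substitutions,
a `Fam`-valued presheaf of types and terms, a chosen terminal object, and
context comprehension. -/
structure CwF where
  Ctx : Type u
  Hom : Ctx → Ctx → Type v
  id : (Γ : Ctx) → Hom Γ Γ
  comp : {Ξ Δ Γ : Ctx} → Hom Δ Γ → Hom Ξ Δ → Hom Ξ Γ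
  id_comp : ∀ {Δ Γ : Ctx} (γ : Hom Δ Γ), comp (id Γ) γ = γ
  comp_id : ∀ {Δ Γ : Ctx} (γ : Hom Δ Γ), comp γ (id Δ) = γ
  comp_assoc : ∀ {Θ Ξ Δ Γ : Ctx} (γ : Hom Δ Γ) (δ : Hom Ξ Δ) (ξ : Hom Θ Ξ),
    comp (comp γ δ) ξ = comp γ (comp δ ξ)
  Ty : Ctx → Type w
  Tm : (Γ : Ctx) → Ty Γ → Type x
  subTy : {Δ Γ : Ctx} → Ty Γ → Hom Δ Γ → Ty Δ
  subTm : {Δ Γ : Ctx} → {A : Ty Γ} → Tm Γ A → (γ : Hom Δ Γ) → Tm Δ (subTy A γ)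
  subTy_id : ∀ {Γ : Ctx} (A : Ty Γ), subTy A (id Γ) = A
  subTy_comp : ∀ {Ξ Δ Γ : Ctx} (A : Ty Γ) (γ : Hom Δ Γ) (δ : Hom Ξ Δ),
    subTy A (comp γ δ) = subTy (subTy A γ) δ
  subTm_id : ∀ {Γ : Ctx} {A : Ty Γ} (a : Tm Γ A), HEq (subTm a (id Γ)) a
  subTm_comp : ∀ {Ξ Δ Γ : Ctx} {A : Ty Γ} (a : Tm Γ A) (γ : Hom Δ Γ) (δ : Hom Ξ Δ),
    HEq (subTm a (comp γ δ)) (subTm (subTm a γ) δ)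
  one : Ctx
  bang : (Γ : Ctx) → Hom Γ one
  bang_unique : ∀ {Γ : Ctx} (γ : Hom Γ one), γ = bang Γ
  ext : (Γ : Ctx) → Ty Γ → Ctx
  p : {Γ : Ctx} → (A : Ty Γ) → Hom (ext Γ A) Γ
  q : {Γ : Ctx} → (A : Ty Γ) → Tm (ext Γ A) (subTy A (p A))
  pair : {Δ Γ : Ctx} → (A : Ty Γ) → (γ : Hom Δ Γ) → Tm Δ (subTy A γ) → Hom Δ (ext Γ A)
  p_pair : ∀ {Δ Γ : Ctx} (A : Ty Γ) (γ : Hom Δ Γ) (a : Tm Δ (subTy A γ)),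
    comp (p A) (pair A γ a) = γ
  q_pair : ∀ {Δ Γ : Ctx} (A : Ty Γ) (γ : Hom Δ Γ) (a : Tm Δ (subTy A γ)),
    HEq (subTm (q A) (pair A γ a)) a
  pair_unique : ∀ {Δ Γ : Ctx} (A : Ty Γ) (γ : Hom Δ Γ) (a : Tm Δ (subTy A γ))
    (δ : Hom Δ (ext Γ A)), comp (p A) δ = γ → HEq (subTm (q A) δ) a → δ = pair A γ a

/-- A strict cwf-morphism: a functor together with a natural transformation of
`Fam`-valued presheaves, preserving the terminal object and context comprehension
on the nose. -/
structure CwFHom (C : CwF.{u, v, w, x}) (D : CwF.{u', v', w', x'}) where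
  obj : C.Ctx → D.Ctx
  map : {Δ Γ : C.Ctx} → C.Hom Δ Γ → D.Hom (obj Δ) (obj Γ)
  map_id : ∀ Γ : C.Ctx, map (C.id Γ) = D.id (obj Γ)
  map_comp : ∀ {Ξ Δ Γ : C.Ctx} (γ : C.Hom Δ Γ) (δ : C.Hom Ξ Δ),
    map (C.comp γ δ) = D.comp (map γ) (map δ)
  mapTy : {Γ : C.Ctx} → C.Ty Γ → D.Ty (obj Γ)
  mapTm : {Γ : C.Ctx} → {A : C.Ty Γ} → C.Tm Γ A → D.Tm (obj Γ) (mapTy A)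
  mapTy_sub : ∀ {Δ Γ : C.Ctx} (A : C.Ty Γ) (γ : C.Hom Δ Γ),
    mapTy (C.subTy A γ) = D.subTy (mapTy A) (map γ)
  mapTm_sub : ∀ {Δ Γ : C.Ctx} {A : C.Ty Γ} (a : C.Tm Γ A) (γ : C.Hom Δ Γ),
    HEq (mapTm (C.subTm a γ)) (D.subTm (mapTm a) (map γ))
  obj_one : obj C.one = D.one
  obj_ext : ∀ {Γ : C.Ctx} (A : C.Ty Γ), obj (C.ext Γ A) = D.ext (obj Γ) (mapTy A)
  map_p : ∀ {Γ : C.Ctx} (A : C.Ty Γ), HEq (map (C.p A)) (D.p (mapTy A))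
  map_q : ∀ {Γ : C.Ctx} (A : C.Ty Γ), HEq (mapTm (C.q A)) (D.q (mapTy A))

/-- A "category of cwfs with structure": a collection of objects, each with an
underlying small cwf, together with a predicate singling out which strict
cwf-morphisms of underlying cwfs are structure-preserving morphisms.
The categories `CwF_Σ` of cwfs with a `Σ`-structure are of this shape. -/
structure SigCat : Type (u + 2) where
  Obj : Type (u + 1)
  cwf : Obj → CwF.{u, u, u, u}
  Mor : (C D : Obj) → CwFHom (cwf C) (cwf D) → Prop

/-- A uniform family of contexts: a choice of context `Γ_C` in each cwf with
structure `C`, preserved on the nose by all structure-preserving morphisms. -/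
structure UnifCtx (S : SigCat.{u}) : Type (u + 1) where
  fam : (C : S.Obj) → (S.cwf C).Ctx
  uniform : ∀ {C D : S.Obj} (F : CwFHom (S.cwf C) (S.cwf D)),
    S.Mor C D F → F.obj (fam C) = fam D

/-- A uniform family of types over a uniform family of contexts. -/
structure UnifTy (S : SigCat.{u}) (Γ : UnifCtx S) : Type (u + 1) where
  fam : (C : S.Obj) → (S.cwf C).Ty (Γ.fam C)
  uniform : ∀ {C D : S.Obj} (F : CwFHom (S.cwf C) (S.cwf D)),
    S.Mor C D F → HEq (F.mapTy (fam C)) (fam D)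

/-- A uniform family of terms of a uniform family of types. -/
structure UnifTm (S : SigCat.{u}) (Γ : UnifCtx S) (A : UnifTy S Γ) : Type (u + 1) where
  fam : (C : S.Obj) → (S.cwf C).Tm (Γ.fam C) (A.fam C)
  uniform : ∀ {C D : S.Obj} (F : CwFHom (S.cwf C) (S.cwf D)),
    S.Mor C D F → HEq (F.mapTm (fam C)) (fam D)

/-- The category of models of the empty signature: `CwF_∅ = CwF`. -/
def SigCat.empty : SigCat.{u} where
  Obj := CwF.{u, u, u, u}
  cwf := fun C => C
  Mor := fun _ _ _ => True

/-- Extending a signature by a new sort symbol `S` relative to a uniform family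
of contexts `Γ`: objects are pairs `(C, S_C)` with `S_C ∈ Ty_C(Γ_C)`, and
morphisms are those `F` with `F(S_C) = S_D`. -/
def SigCat.addSort (S : SigCat.{u}) (Γ : UnifCtx S) : SigCat.{u} where
  Obj := Σ C : S.Obj, (S.cwf C).Ty (Γ.fam C)
  cwf := fun C => S.cwf C.1
  Mor := fun C D F => S.Mor C.1 D.1 F ∧ HEq (F.mapTy C.2) D.2

/-- Extending a signature by a new operator symbol `f` relative to a uniform
family of contexts `Γ` and a uniform family of types `A`: objects are pairs
`(C, f_C)` with `f_C ∈ Tm_C(Γ_C, A_C)`, and morphisms are those `F` with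
`F(f_C) = f_D`. -/
def SigCat.addOp (S : SigCat.{u}) (Γ : UnifCtx S) (A : UnifTy S Γ) : SigCat.{u} where
  Obj := Σ C : S.Obj, (S.cwf C).Tm (Γ.fam C) (A.fam C)
  cwf := fun C => S.cwf C.1
  Mor := fun C D F => S.Mor C.1 D.1 F ∧ HEq (F.mapTm C.2) D.2

/-- Extending a signature by a new equation `a = a'` between uniform families
of terms: the full subcategory of objects `C` with `a_C = a'_C`. -/
def SigCat.addEq (S : SigCat.{u}) (Γ : UnifCtx S) (A : UnifTy S Γ)
    (a a' : UnifTm S Γ A) : SigCat.{u} where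
  Obj := { C : S.Obj // a.fam C = a'.fam C }
  cwf := fun C => S.cwf C.1
  Mor := fun C D F => S.Mor C.1 D.1 F

/-- Valid signatures, presented via their categories of models: the inductive
closure of `CwF_∅ = CwF` under extension by sort symbols, operator symbols and
equations relative to uniform families. -/
inductive SigCat.Valid : SigCat.{u} → Prop
  | empty : SigCat.Valid SigCat.empty
  | addSort (S : SigCat.{u}) (Γ : UnifCtx S) :
      SigCat.Valid S → SigCat.Valid (S.addSort Γ)
  | addOp (S : SigCat.{u}) (Γ : UnifCtx S) (A : UnifTy S Γ) :
      SigCat.Valid S → SigCat.Valid (S.addOp Γ A)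
  | addEq (S : SigCat.{u}) (Γ : UnifCtx S) (A : UnifTy S Γ) (a a' : UnifTm S Γ A) :
      SigCat.Valid S → SigCat.Valid (S.addEq Γ A a a')

/-- `I` is an initial object of the category of cwfs with structure `S`:
to every object there is a unique structure-preserving strict cwf-morphism
from `I`. -/
def SigCat.IsInitial (S : SigCat.{u}) (I : S.Obj) : Prop :=
  ∀ C : S.Obj, ∃! F : CwFHom (S.cwf I) (S.cwf C), S.Mor I C F

theorem CwFHom.heq_map {C : CwF.{u, v, w, x}} {D : CwF.{u', v', w', x'}} (F : CwFHom C D)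
    {Δ Δ' Γ Γ' : C.Ctx} {γ : C.Hom Δ Γ} {γ' : C.Hom Δ' Γ'} (h₁ : Δ = Δ') (h₂ : Γ = Γ')
    (h : HEq γ γ') : HEq (F.map γ) (F.map γ') := by
  subst h₁ h₂ h; rfl

theorem CwFHom.heq_mapTy {C : CwF.{u, v, w, x}} {D : CwF.{u', v', w', x'}} (F : CwFHom C D)
    {Γ Γ' : C.Ctx} {A : C.Ty Γ} {A' : C.Ty Γ'} (h₁ : Γ = Γ')
    (h : HEq A A') : HEq (F.mapTy A) (F.mapTy A') := by
  subst h₁ h; rfl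

theorem CwFHom.heq_mapTm {C : CwF.{u, v, w, x}} {D : CwF.{u', v', w', x'}} (F : CwFHom C D)
    {Γ Γ' : C.Ctx} {A : C.Ty Γ} {A' : C.Ty Γ'} {a : C.Tm Γ A} {a' : C.Tm Γ' A'} (h₁ : Γ = Γ')
    (h₂ : HEq A A') (h : HEq a a') : HEq (F.mapTm a) (F.mapTm a') := by
  subst h₁ h₂ h; rfl

theorem CwF.heq_subTy {C : CwF.{u, v, w, x}} {Δ Δ' Γ : C.Ctx} (A : C.Ty Γ)
    {γ : C.Hom Δ Γ} {γ' : C.Hom Δ' Γ} (h₁ : Δ = Δ') (h : HEq γ γ') :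
    HEq (C.subTy A γ) (C.subTy A γ') := by
  subst h₁ h; rfl

/-- The identity strict cwf-morphism. -/
def CwFHom.idHom (C : CwF.{u, v, w, x}) : CwFHom C C where
  obj := fun Γ => Γ
  map := fun γ => γ
  map_id := fun _ => rfl
  map_comp := fun _ _ => rfl
  mapTy := fun A => A
  mapTm := fun a => a
  mapTy_sub := fun _ _ => rfl
  mapTm_sub := fun _ _ => HEq.rfl
  obj_one := rfl
  obj_ext := fun _ => rfl
  map_p := fun _ => HEq.rfl
  map_q := fun _ => HEq.rfl

/-- Composition of strict cwf-morphisms. -/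
def CwFHom.compHom {C D E : CwF.{u, v, w, x}} (G : CwFHom D E) (F : CwFHom C D) :
    CwFHom C E where
  obj := fun Γ => G.obj (F.obj Γ)
  map := fun γ => G.map (F.map γ)
  map_id := fun Γ => by rw [F.map_id, G.map_id]
  map_comp := fun γ δ => by rw [F.map_comp, G.map_comp]
  mapTy := fun A => G.mapTy (F.mapTy A)
  mapTm := fun a => G.mapTm (F.mapTm a)
  mapTy_sub := fun A γ => by rw [F.mapTy_sub, G.mapTy_sub]
  mapTm_sub := fun a γ =>
    (G.heq_mapTm rfl (heq_of_eq (F.mapTy_sub _ γ)) (F.mapTm_sub a γ)).trans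
      (G.mapTm_sub (F.mapTm a) (F.map γ))
  obj_one := by rw [F.obj_one, G.obj_one]
  obj_ext := fun A => by rw [F.obj_ext, G.obj_ext]
  map_p := fun A => (G.heq_map (F.obj_ext A) rfl (F.map_p A)).trans (G.map_p _)
  map_q := fun A =>
    (G.heq_mapTm (F.obj_ext A)
      ((heq_of_eq (F.mapTy_sub A _)).trans
        (CwF.heq_subTy _ (F.obj_ext A) (F.map_p A)))
      (F.map_q A)).trans (G.map_q _)

theorem SigCat.Valid.mor_id {S : SigCat.{u}} (hS : S.Valid) :
    ∀ C : S.Obj, S.Mor C C (CwFHom.idHom (S.cwf C)) := by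
  induction hS with
  | empty => exact fun _ => trivial
  | addSort S Γ _ ih => exact fun C => ⟨ih C.1, HEq.rfl⟩
  | addOp S Γ A _ ih => exact fun C => ⟨ih C.1, HEq.rfl⟩
  | addEq S Γ A a a' _ ih => exact fun C => ih C.1

theorem SigCat.Valid.mor_comp {S : SigCat.{u}} (hS : S.Valid) :
    ∀ {C D E : S.Obj} (G : CwFHom (S.cwf D) (S.cwf E)) (F : CwFHom (S.cwf C) (S.cwf D)),
      S.Mor D E G → S.Mor C D F → S.Mor C E (G.compHom F) := by
  induction hS with
  | empty => exact fun _ _ _ _ => trivial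
  | addSort S Γ _ ih =>
    exact fun G F hG hF => ⟨ih G F hG.1 hF.1,
      (G.heq_mapTy (Γ.uniform F hF.1) hF.2).trans hG.2⟩
  | addOp S Γ A _ ih =>
    exact fun G F hG hF => ⟨ih G F hG.1 hF.1,
      (G.heq_mapTm (Γ.uniform F hF.1) (A.uniform F hF.1) hF.2).trans hG.2⟩
  | addEq S Γ A a a' _ ih => exact fun G F hG hF => ih G F hG hF

/-- For a valid signature `Σ` with initial object `I` and interpretation
morphisms `⟦-⟧_C : I → C`, the map `Γ₀ ↦ (⟦Γ₀⟧_C)_C` is a bijection between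
the objects (contexts) of `I` and the uniform families of contexts over
`CwF_Σ`: each `(⟦Γ₀⟧_C)_C` is a uniform family, the map is injective, and
every uniform family of contexts arises this way. -/
theorem initial_ctx_bijection (S : SigCat.{u}) (hS : S.Valid)
    (I : S.Obj) (hI : S.IsInitial I)
    (interp : (C : S.Obj) → CwFHom (S.cwf I) (S.cwf C))
    (hinterp : ∀ C : S.Obj, S.Mor I C (interp C)) :
    (∀ (Γ₀ : (S.cwf I).Ctx) {C D : S.Obj} (F : CwFHom (S.cwf C) (S.cwf D)),
      S.Mor C D F → F.obj ((interp C).obj Γ₀) = (interp D).obj Γ₀) ∧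
    Function.Injective (fun Γ₀ : (S.cwf I).Ctx => fun C : S.Obj => (interp C).obj Γ₀) ∧
    (∀ U : UnifCtx S, ∃ Γ₀ : (S.cwf I).Ctx, ∀ C : S.Obj, (interp C).obj Γ₀ = U.fam C) := by
  refine ⟨?_, ?_, ?_⟩
  · intro Γ₀ C D F hF
    have h : F.compHom (interp C) = interp D :=
      (hI D).unique (hS.mor_comp F (interp C) hF (hinterp C)) (hinterp D)
    rw [← h]
    rfl
  · intro Γ₀ Γ₁ h
    have hid : interp I = CwFHom.idHom (S.cwf I) :=
      (hI I).unique (hinterp I) (hS.mor_id I)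
    have h' : (interp I).obj Γ₀ = (interp I).obj Γ₁ := congrFun h I
    rw [hid] at h'
    exact h'
  · intro U
    exact ⟨U.fam I, fun C => U.uniform (interp C) (hinterp C)⟩
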